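/- arXiv:1312.3873 — 2 statements merged into one kernel-verified Lean document; each statement's English description precedes it below -/
import Mathlib

section
/- For all w, ξ ∈ S³ and all z in the open unit ball B of ℍ with z ≠ w and z ≠ ξ, the identity (σ*_z P(z, w))·(σ_z P(z, ξ)) + (σ*_z P(z, ξ))·(σ_z P(z, w)) = Δ_z [P(z, w)·P(z, ξ)] holds, and in particular this quaternion is real; moreover (σ*_z P(z, w))* = σ_z P(z, w). -/
open MeasureTheory Metric
open scoped Quaternion

noncomputable instance : MeasurableSpace ℍ[ℝ] := borel _
instance : BorelSpace ℍ[ℝ] := ⟨rfl⟩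

/-- The standard basis `1, i₁, i₂, i₃` of the quaternions over ℝ. -/
noncomputable def qe : Fin 4 → ℍ[ℝ]
  | 0 => ⟨1, 0, 0, 0⟩
  | 1 => ⟨0, 1, 0, 0⟩
  | 2 => ⟨0, 0, 1, 0⟩
  | 3 => ⟨0, 0, 0, 1⟩

/-- The Dirac operator `σf(z) = ∑ⱼ (∂f/∂zⱼ)(z)·iⱼ` (with `i₀ = 1`), where `∂/∂zⱼ` is
the partial derivative in the `j`-th real coordinate direction of `ℍ ≅ ℝ⁴`. -/
noncomputable def Dirac (f : ℍ[ℝ] → ℍ[ℝ]) (z : ℍ[ℝ]) : ℍ[ℝ] :=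
  ∑ j : Fin 4, fderiv ℝ f z (qe j) * qe j

/-- The adjoint Dirac operator `σ*f(z) = ∑ⱼ (∂f/∂zⱼ)(z)·iⱼ*`. -/
noncomputable def DiracStar (f : ℍ[ℝ] → ℍ[ℝ]) (z : ℍ[ℝ]) : ℍ[ℝ] :=
  ∑ j : Fin 4, fderiv ℝ f z (qe j) * star (qe j)

/-- The Laplace operator `Δf(z) = ∑ⱼ ∂²f/∂zⱼ²(z)` in the four real coordinates of `ℍ ≅ ℝ⁴`. -/
noncomputable def qLap (f : ℍ[ℝ] → ℍ[ℝ]) (z : ℍ[ℝ]) : ℍ[ℝ] :=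
  ∑ j : Fin 4, fderiv ℝ (fun w => fderiv ℝ f w (qe j)) z (qe j)

/-- The Poisson kernel `P(z, ξ) = (1 − |z|²)/|z − ξ|⁴` of the unit ball of `ℍ ≅ ℝ⁴`. -/
noncomputable def pker (z ξ : ℍ[ℝ]) : ℝ := (1 - ‖z‖ ^ 2) / ‖z - ξ‖ ^ 4

/-- The Dirac operator applied to the Poisson kernel in the variable `z`. -/
noncomputable def dP (ξ z : ℍ[ℝ]) : ℍ[ℝ] :=
  Dirac (fun w => ((pker w ξ : ℝ) : ℍ[ℝ])) z

/-- The adjoint Dirac operator applied to the Poisson kernel in the variable `z`. -/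
noncomputable def dstarP (ξ z : ℍ[ℝ]) : ℍ[ℝ] :=
  DiracStar (fun w => ((pker w ξ : ℝ) : ℍ[ℝ])) z

theorem re_qe (j : Fin 4) : (qe j).re = if j = 0 then 1 else 0 := by
  fin_cases j <;> rfl

theorem imI_qe (j : Fin 4) : (qe j).imI = if j = 1 then 1 else 0 := by
  fin_cases j <;> rfl

theorem imJ_qe (j : Fin 4) : (qe j).imJ = if j = 2 then 1 else 0 := by
  fin_cases j <;> rfl

theorem imK_qe (j : Fin 4) : (qe j).imK = if j = 3 then 1 else 0 := by
  fin_cases j <;> rfl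

/-- The real Laplace operator in the four coordinates of `ℍ ≅ ℝ⁴`. -/
noncomputable def realLap (f : ℍ[ℝ] → ℝ) (z : ℍ[ℝ]) : ℝ :=
  ∑ j : Fin 4, fderiv ℝ (fun w => fderiv ℝ f w (qe j)) z (qe j)

theorem fderiv_quaternion_coe {f : ℍ[ℝ] → ℝ} {z : ℍ[ℝ]} (hf : DifferentiableAt ℝ f z)
    (e : ℍ[ℝ]) :
    fderiv ℝ (fun w => ((f w : ℝ) : ℍ[ℝ])) z e = ((fderiv ℝ f z e : ℝ) : ℍ[ℝ]) := by
  have h := (algebraMapCLM ℝ ℍ[ℝ]).hasFDerivAt.comp z hf.hasFDerivAt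
  have h' : HasFDerivAt (fun w => ((f w : ℝ) : ℍ[ℝ]))
      ((algebraMapCLM ℝ ℍ[ℝ]).comp (fderiv ℝ f z)) z := h
  rw [h'.fderiv]
  rfl

theorem eventually_differentiableAt {f : ℍ[ℝ] → ℝ} {z : ℍ[ℝ]} (hf : ContDiffAt ℝ 2 f z) :
    ∀ᶠ w in nhds z, DifferentiableAt ℝ f w :=
  (hf.eventually (by simp)).mono fun _ h => h.differentiableAt (by simp)

theorem differentiableAt_fderiv_apply {f : ℍ[ℝ] → ℝ} {z : ℍ[ℝ]} (hf : ContDiffAt ℝ 2 f z)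
    (e : ℍ[ℝ]) : DifferentiableAt ℝ (fun w => fderiv ℝ f w e) z :=
  ((hf.fderiv_right (m := 1) (by norm_num)).differentiableAt (by simp)).clm_apply
    (differentiableAt_const e)

theorem qLap_coe {f : ℍ[ℝ] → ℝ} {z : ℍ[ℝ]} (hf : ContDiffAt ℝ 2 f z) :
    qLap (fun w => ((f w : ℝ) : ℍ[ℝ])) z = ((realLap f z : ℝ) : ℍ[ℝ]) := by
  have key (j : Fin 4) :
      fderiv ℝ (fun v => fderiv ℝ (fun w => ((f w : ℝ) : ℍ[ℝ])) v (qe j)) z (qe j) =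
        ((fderiv ℝ (fun v => fderiv ℝ f v (qe j)) z (qe j) : ℝ) : ℍ[ℝ]) := by
    rw [← fderiv_quaternion_coe (differentiableAt_fderiv_apply hf _)]
    congr 1
    exact Filter.EventuallyEq.fderiv_eq
      ((eventually_differentiableAt hf).mono fun v hv => fderiv_quaternion_coe hv _)
  simp only [qLap, realLap, Fin.sum_univ_four, key, Quaternion.coe_add]

theorem realLap_mul {f g : ℍ[ℝ] → ℝ} {z : ℍ[ℝ]} (hf : ContDiffAt ℝ 2 f z)
    (hg : ContDiffAt ℝ 2 g z) :
    realLap (fun w => f w * g w) z = f z * realLap g z + g z * realLap f z +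
      2 * ∑ j : Fin 4, fderiv ℝ f z (qe j) * fderiv ℝ g z (qe j) := by
  have key (j : Fin 4) :
      fderiv ℝ (fun v => fderiv ℝ (fun w => f w * g w) v (qe j)) z (qe j) =
        f z * fderiv ℝ (fun v => fderiv ℝ g v (qe j)) z (qe j) +
        g z * fderiv ℝ (fun v => fderiv ℝ f v (qe j)) z (qe j) +
        2 * (fderiv ℝ f z (qe j) * fderiv ℝ g z (qe j)) := by
    have h1 : (fun v => fderiv ℝ (fun w => f w * g w) v (qe j)) =ᶠ[nhds z]
        fun v => f v * fderiv ℝ g v (qe j) + g v * fderiv ℝ f v (qe j) := by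
      filter_upwards [eventually_differentiableAt hf, eventually_differentiableAt hg] with v hv hv'
      rw [fderiv_fun_mul hv hv']
      simp
    have hf' := hf.differentiableAt (by simp)
    have hg' := hg.differentiableAt (by simp)
    have hf'' := differentiableAt_fderiv_apply hf (qe j)
    have hg'' := differentiableAt_fderiv_apply hg (qe j)
    rw [h1.fderiv_eq, fderiv_fun_add (hf'.fun_mul hg'') (hg'.fun_mul hf''), fderiv_fun_mul hf' hg'',
      fderiv_fun_mul hg' hf'']
    simp
    ring
  simp only [realLap, key, Fin.sum_univ_four]
  ring

theorem contDiffAt_pker {z ξ : ℍ[ℝ]} (h : z ≠ ξ) : ContDiffAt ℝ 2 (fun v => pker v ξ) z := by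
  have h0 : ‖z - ξ‖ ^ 4 ≠ 0 := pow_ne_zero _ (norm_ne_zero_iff.2 (sub_ne_zero.2 h))
  have hN : ContDiffAt ℝ 2 (fun v : ℍ[ℝ] => ‖v - ξ‖) z :=
    (contDiffAt_id.sub contDiffAt_const).norm ℝ (sub_ne_zero.2 h)
  have hS : ContDiffAt ℝ 2 (fun v : ℍ[ℝ] => ‖v‖ ^ 2) z := (contDiff_norm_sq ℝ).contDiffAt
  exact (contDiffAt_const.sub hS).div (hN.pow 4) h0

theorem norm_sub_sq_ne_zero {z ξ : ℍ[ℝ]} (h : z ≠ ξ) : ‖z - ξ‖ ^ 2 ≠ 0 :=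
  pow_ne_zero _ (norm_ne_zero_iff.2 (sub_ne_zero.2 h))

theorem fderiv_norm_sub_sq (ξ v e : ℍ[ℝ]) :
    DifferentiableAt ℝ (fun v : ℍ[ℝ] => ‖v - ξ‖ ^ 2) v ∧
      fderiv ℝ (fun v : ℍ[ℝ] => ‖v - ξ‖ ^ 2) v e = 2 * inner ℝ (v - ξ) e := by
  have h := ((hasFDerivAt_id (𝕜 := ℝ) v).sub_const ξ).norm_sq
  have h' : HasFDerivAt (fun v : ℍ[ℝ] => ‖v - ξ‖ ^ 2) _ v := h
  refine ⟨h'.differentiableAt, ?_⟩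
  rw [h'.fderiv]
  simp [inner_sub_left]

theorem fderiv_inner_sub (ξ v e : ℍ[ℝ]) :
    DifferentiableAt ℝ (fun v : ℍ[ℝ] => inner ℝ (v - ξ) e) v ∧
      fderiv ℝ (fun v : ℍ[ℝ] => inner ℝ (v - ξ) e) v e = inner ℝ e e := by
  have h : HasFDerivAt (fun v : ℍ[ℝ] => inner ℝ (v - ξ) e) _ v :=
    ((hasFDerivAt_id (𝕜 := ℝ) v).sub_const ξ).inner ℝ (hasFDerivAt_const e v)
  refine ⟨h.differentiableAt, ?_⟩
  rw [h.fderiv]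
  simp

theorem hasDerivAt_line {f : ℍ[ℝ] → ℝ} {v : ℍ[ℝ]} (hf : DifferentiableAt ℝ f v) (e : ℍ[ℝ]) :
    HasDerivAt (fun t : ℝ => f (v + t • e)) (fderiv ℝ f v e) 0 := by
  have h : HasLineDerivAt ℝ f (fderiv ℝ f v e) v e := hf.hasFDerivAt.hasLineDerivAt e
  exact h

theorem fderiv_pker {v ξ : ℍ[ℝ]} (h : v ≠ ξ) (e : ℍ[ℝ]) :
    fderiv ℝ (fun v => pker v ξ) v e =
      -2 * inner ℝ v e / (‖v - ξ‖ ^ 2) ^ 2 -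
        4 * (1 - ‖v‖ ^ 2) * inner ℝ (v - ξ) e / (‖v - ξ‖ ^ 2) ^ 3 := by
  have hd := hasDerivAt_line ((contDiffAt_pker h).differentiableAt (by simp)) e
  have hN := hasDerivAt_line (fderiv_norm_sub_sq ξ v e).1 e
  have hS := hasDerivAt_line (fderiv_norm_sub_sq 0 v e).1 e
  rw [(fderiv_norm_sub_sq ξ v e).2] at hN
  rw [(fderiv_norm_sub_sq 0 v e).2] at hS
  simp only [sub_zero] at hS
  have h0 := norm_sub_sq_ne_zero h
  have hn : ‖v - ξ‖ ≠ 0 := norm_ne_zero_iff.2 (sub_ne_zero.2 h)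
  have hq := (hS.const_sub 1).fun_div (hN.fun_pow 2) (pow_ne_zero _ (by simpa using h0))
  have e1 : (fun t : ℝ => pker (v + t • e) ξ) =
      fun t : ℝ => (1 - ‖v + t • e‖ ^ 2) / (‖v + t • e - ξ‖ ^ 2) ^ 2 := by
    funext t
    simp only [pker, ← pow_mul]
  rw [e1] at hd
  rw [hd.unique hq]
  simp only [zero_smul, add_zero]
  field_simp
  ring

theorem fderiv_fderiv_pker {v ξ : ℍ[ℝ]} (h : v ≠ ξ) (e : ℍ[ℝ]) :
    fderiv ℝ (fun v => fderiv ℝ (fun v => pker v ξ) v e) v e =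
      (-2 * inner ℝ e e * (‖v - ξ‖ ^ 2) ^ 2 +
        16 * inner ℝ v e * inner ℝ (v - ξ) e * ‖v - ξ‖ ^ 2 +
        24 * (1 - ‖v‖ ^ 2) * inner ℝ (v - ξ) e ^ 2 -
        4 * (1 - ‖v‖ ^ 2) * inner ℝ e e * ‖v - ξ‖ ^ 2) / (‖v - ξ‖ ^ 2) ^ 4 := by
  have hd := hasDerivAt_line (differentiableAt_fderiv_apply (contDiffAt_pker h) e) e
  have hc : Filter.Tendsto (fun t : ℝ => v + t • e) (nhds 0) (nhds v) := by
    have : Continuous (fun t : ℝ => v + t • e) := by fun_prop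
    simpa using this.tendsto 0
  have hev := (hc.eventually (isOpen_ne.mem_nhds h)).mono fun t ht => fderiv_pker ht e
  have hN := hasDerivAt_line (fderiv_norm_sub_sq ξ v e).1 e
  have hS := hasDerivAt_line (fderiv_norm_sub_sq 0 v e).1 e
  have hI := hasDerivAt_line (fderiv_inner_sub ξ v e).1 e
  have hJ := hasDerivAt_line (fderiv_inner_sub 0 v e).1 e
  rw [(fderiv_norm_sub_sq ξ v e).2] at hN
  rw [(fderiv_norm_sub_sq 0 v e).2] at hS
  rw [(fderiv_inner_sub ξ v e).2] at hI
  rw [(fderiv_inner_sub 0 v e).2] at hJ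
  simp only [sub_zero] at hS hJ
  have h0 := norm_sub_sq_ne_zero h
  have hn : ‖v - ξ‖ ≠ 0 := norm_ne_zero_iff.2 (sub_ne_zero.2 h)
  have hN0 : ‖v + (0 : ℝ) • e - ξ‖ ^ 2 ≠ 0 := by simpa using h0
  have hq := ((hJ.const_mul (-2)).fun_div (hN.fun_pow 2) (pow_ne_zero _ hN0)).fun_sub
    ((((hS.const_sub 1).const_mul 4).fun_mul hI).fun_div (hN.fun_pow 3) (pow_ne_zero _ hN0))
  rw [hd.unique (hq.congr_of_eventuallyEq hev)]
  simp only [zero_smul, add_zero]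
  field_simp
  ring

theorem realLap_pker {v ξ : ℍ[ℝ]} (hξ : ‖ξ‖ = 1) (h : v ≠ ξ) :
    realLap (fun v => pker v ξ) v = 0 := by
  have hsq (q : ℍ[ℝ]) : ‖q‖ ^ 2 = q.re ^ 2 + q.imI ^ 2 + q.imJ ^ 2 + q.imK ^ 2 := by
    rw [← Quaternion.normSq_def', Quaternion.normSq_eq_norm_mul_self, sq]
  have h1 : ξ.re ^ 2 + ξ.imI ^ 2 + ξ.imJ ^ 2 + ξ.imK ^ 2 = 1 := by rw [← hsq, hξ, one_pow]
  simp only [realLap, fderiv_fderiv_pker h, ← Finset.sum_div]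
  refine div_eq_zero_iff.2 (Or.inl ?_)
  simp only [Fin.sum_univ_four, Quaternion.inner_def, hsq]
  simp [re_qe, imI_qe, imJ_qe, imK_qe]
  linear_combination (-8 * ((v.re - ξ.re) ^ 2 + (v.imI - ξ.imI) ^ 2 + (v.imJ - ξ.imJ) ^ 2 +
    (v.imK - ξ.imK) ^ 2)) * h1

theorem dP_components {z ξ : ℍ[ℝ]} (h : z ≠ ξ) :
    (dP ξ z).re = fderiv ℝ (fun v => pker v ξ) z (qe 0) ∧
    (dP ξ z).imI = fderiv ℝ (fun v => pker v ξ) z (qe 1) ∧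
    (dP ξ z).imJ = fderiv ℝ (fun v => pker v ξ) z (qe 2) ∧
    (dP ξ z).imK = fderiv ℝ (fun v => pker v ξ) z (qe 3) := by
  have hd := (contDiffAt_pker h).differentiableAt (by simp)
  simp only [dP, Dirac, fderiv_quaternion_coe hd, Fin.sum_univ_four]
  simp [re_qe, imI_qe, imJ_qe, imK_qe]

theorem dstarP_eq {z ξ : ℍ[ℝ]} (h : z ≠ ξ) : dstarP ξ z = star (dP ξ z) := by
  have hd := (contDiffAt_pker h).differentiableAt (by simp)
  simp only [dstarP, DiracStar, dP, Dirac, fderiv_quaternion_coe hd, star_sum, star_mul,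
    Quaternion.star_coe, Quaternion.coe_commutes]

theorem dstarP_mul_dP_add {z w ξ : ℍ[ℝ]} (hw : z ≠ w) (hξ : z ≠ ξ) :
    dstarP w z * dP ξ z + dstarP ξ z * dP w z =
      ((2 * ∑ j : Fin 4, fderiv ℝ (fun v => pker v w) z (qe j) *
        fderiv ℝ (fun v => pker v ξ) z (qe j) : ℝ) : ℍ[ℝ]) := by
  obtain ⟨h0, h1, h2, h3⟩ := dP_components hw
  obtain ⟨k0, k1, k2, k3⟩ := dP_components hξ
  rw [dstarP_eq hw, dstarP_eq hξ, Fin.sum_univ_four, ← h0, ← h1, ← h2, ← h3, ← k0, ← k1, ← k2,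
    ← k3]
  ext <;> simp <;> ring

/-- For `w, ξ ∈ S³` and `z ∈ B` with `z ≠ w`, `z ≠ ξ`:
`(σ*_z P(z,w))·(σ_z P(z,ξ)) + (σ*_z P(z,ξ))·(σ_z P(z,w)) = Δ_z[P(z,w)·P(z,ξ)]`,
this common value is a real quaternion, and `(σ*_z P(z,w))* = σ_z P(z,w)`. -/
theorem poisson_kernel_dirac_identity
    (w ξ : ℍ[ℝ]) (hw : w ∈ sphere (0 : ℍ[ℝ]) 1) (hξ : ξ ∈ sphere (0 : ℍ[ℝ]) 1)
    (z : ℍ[ℝ]) (hz : z ∈ ball (0 : ℍ[ℝ]) 1) (hzw : z ≠ w) (hzξ : z ≠ ξ) :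
    dstarP w z * dP ξ z + dstarP ξ z * dP w z =
        qLap (fun v => ((pker v w * pker v ξ : ℝ) : ℍ[ℝ])) z ∧
    dstarP w z * dP ξ z + dstarP ξ z * dP w z =
        ((((dstarP w z * dP ξ z + dstarP ξ z * dP w z).re : ℝ)) : ℍ[ℝ]) ∧
    star (dstarP w z) = dP w z := by
  have h1 : ‖w‖ = 1 := by simpa using hw
  have h2 : ‖ξ‖ = 1 := by simpa using hξ
  rw [dstarP_mul_dP_add hzw hzξ, qLap_coe ((contDiffAt_pker hzw).mul (contDiffAt_pker hzξ)),
    realLap_mul (contDiffAt_pker hzw) (contDiffAt_pker hzξ), realLap_pker h1 hzw,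
    realLap_pker h2 hzξ, dstarP_eq hzw, star_star]
  simp
end

section
/- Let 1 < p < ∞. The space K_p(B, ℍ), equipped with the Hardy norm ‖f‖_p = (sup_{0<r≤1} r^{−3} ∫_{S³} |f(r y)|^p ψ(dy))^{1/p}, is complete; that is, K_p(B, ℍ) is a Banach left module over the quaternion skew field ℍ. -/
open MeasureTheory Metric
open scoped Quaternion ENNReal

/-- The Hardy norm `‖f‖_p = (sup_{0<r≤1} r^{−3} ∫_{S³} |f(r y)|^p ψ(dy))^{1/p}`
(with values in `ℝ≥0∞`). -/
noncomputable def hardyNorm (ψ : Measure ℍ[ℝ]) (p : ℝ) (f : ℍ[ℝ] → ℍ[ℝ]) : ℝ≥0∞ :=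
  (⨆ r ∈ Set.Ioc (0 : ℝ) 1,
    ENNReal.ofReal (r ^ (-(3 : ℝ))) * ∫⁻ y, ENNReal.ofReal (‖f (r • y)‖ ^ p) ∂ψ) ^ (1 / p)

/-- Membership in the Hardy–Dirac module `K_p(B, ℍ)`: measurable, continuously
ℝ-differentiable on `B`, annihilated by the Dirac operator on `B`, finite Hardy norm. -/
def memKp (ψ : Measure ℍ[ℝ]) (p : ℝ) (f : ℍ[ℝ] → ℍ[ℝ]) : Prop :=
  Measurable f ∧ ContDiffOn ℝ 1 f (ball 0 1) ∧
    (∀ z ∈ ball (0 : ℍ[ℝ]) 1, Dirac f z = 0) ∧ hardyNorm ψ p f < ⊤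


open Filter Topology
open scoped InnerProductSpace

/-- Antisymmetric second-order integration by parts: mixed directional derivatives of a compactly
supported `C²` weight and a `C¹` function may be exchanged under the integral. -/
theorem integral_fderiv_smul_fderiv_comm {E F : Type*} [NormedAddCommGroup E] [NormedSpace ℝ E]
    [FiniteDimensional ℝ E] [MeasurableSpace E] [BorelSpace E] [NormedAddCommGroup F]
    [NormedSpace ℝ F] (μ : Measure E) [μ.IsAddHaarMeasure] {v : E → F} {η : E → ℝ}
    (hv : ContDiff ℝ 1 v) (hη : ContDiff ℝ 2 η) (hc : HasCompactSupport η) (a b : E) :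
    ∫ x, fderiv ℝ η x a • fderiv ℝ v x b ∂μ = ∫ x, fderiv ℝ η x b • fderiv ℝ v x a ∂μ := by
  have hη1 : ContDiff ℝ 1 (fderiv ℝ η) := hη.fderiv_right (by norm_num)
  have hsupp (u : E) : HasCompactSupport fun x => fderiv ℝ η x u := hc.fderiv_apply ℝ u
  have hd (u : E) : ContDiff ℝ 1 fun x => fderiv ℝ η x u := hη1.clm_apply contDiff_const
  have hdv (w : E) : Continuous fun x => fderiv ℝ v x w :=
    (hv.continuous_fderiv one_ne_zero).clm_apply continuous_const
  have hdd (u w : E) : Continuous fun x => fderiv ℝ (fun y => fderiv ℝ η y u) x w :=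
    ((hd u).continuous_fderiv one_ne_zero).clm_apply continuous_const
  have key (u w : E) : ∫ x, fderiv ℝ η x u • fderiv ℝ v x w ∂μ =
      - ∫ x, fderiv ℝ (fun y => fderiv ℝ η y u) x w • v x ∂μ := by
    refine integral_smul_fderiv_eq_neg_fderiv_smul_of_integrable ?_ ?_ ?_
      (fun x _ => (hd u).differentiable one_ne_zero x)
      (fun x _ => hv.differentiable one_ne_zero x)
    · exact ((hdd u w).smul hv.continuous).integrable_of_hasCompactSupport
        (((hsupp u).fderiv_apply ℝ w).smul_right)
    · exact ((hd u).continuous.smul (hdv w)).integrable_of_hasCompactSupport (hsupp u).smul_right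
    · exact ((hd u).continuous.smul hv.continuous).integrable_of_hasCompactSupport
        (hsupp u).smul_right
  rw [key, key]
  congr 2
  ext x
  have hx : DifferentiableAt ℝ (fderiv ℝ η) x := hη1.differentiable one_ne_zero x
  have e (u w : E) : fderiv ℝ (fun y => fderiv ℝ η y u) x w = fderiv ℝ (fderiv ℝ η) x w u := by
    rw [fderiv_clm_apply hx (differentiableAt_const u)]
    simp
  rw [e, e, (hη.contDiffAt.isSymmSndFDerivAt (by simp)).eq]

theorem qe_re (j : Fin 4) : (qe j).re = ![1, 0, 0, 0] j := by fin_cases j <;> rfl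

theorem qe_imI (j : Fin 4) : (qe j).imI = ![0, 1, 0, 0] j := by fin_cases j <;> rfl

theorem qe_imJ (j : Fin 4) : (qe j).imJ = ![0, 0, 1, 0] j := by fin_cases j <;> rfl

theorem qe_imK (j : Fin 4) : (qe j).imK = ![0, 0, 0, 1] j := by fin_cases j <;> rfl

/-- The antisymmetrised product rule behind `σ σ̄ = Δ`. -/
theorem sum_smul_eq_of_sum_mul_qe (a : Fin 4 → ℍ[ℝ]) (b : Fin 4 → ℝ)
    (ha : ∑ j, a j * qe j = 0) :
    ∑ j, b j • a j = ∑ j, ∑ k, (b j • a k - b k • a j) * ((2⁻¹ : ℝ) • (qe j * star (qe k))) := by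
  have h1 : ∑ j, b j • a j = ∑ j, b j • a j - (∑ j, a j * qe j) * star (∑ k, b k • qe k) := by
    rw [ha]; simp
  rw [h1]
  simp only [Fin.sum_univ_four]
  ext <;> simp [qe_re, qe_imI, qe_imJ, qe_imK] <;> ring

theorem integral_sum_fderiv_smul_eq_zero {v : ℍ[ℝ] → ℍ[ℝ]} {η : ℍ[ℝ] → ℝ}
    (hv : ContDiff ℝ 1 v) (hη : ContDiff ℝ 2 η) (hc : HasCompactSupport η)
    (hD : ∀ y, fderiv ℝ η y ≠ 0 → Dirac v y = 0) :
    ∫ y, ∑ j, fderiv ℝ η y (qe j) • fderiv ℝ v y (qe j) = 0 := by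
  have hint (a b : ℍ[ℝ]) : Integrable fun x => fderiv ℝ η x a • fderiv ℝ v x b :=
    (((hη.continuous_fderiv two_ne_zero).clm_apply continuous_const).smul
      ((hv.continuous_fderiv one_ne_zero).clm_apply
        continuous_const)).integrable_of_hasCompactSupport (hc.fderiv_apply ℝ a).smul_right
  have hpt (y : ℍ[ℝ]) : ∑ j, fderiv ℝ η y (qe j) • fderiv ℝ v y (qe j) =
      ∑ j, ∑ k, (fderiv ℝ η y (qe j) • fderiv ℝ v y (qe k)
        - fderiv ℝ η y (qe k) • fderiv ℝ v y (qe j)) * ((2⁻¹ : ℝ) • (qe j * star (qe k))) := by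
    by_cases h0 : fderiv ℝ η y = 0
    · simp [h0]
    · exact sum_smul_eq_of_sum_mul_qe _ _ (hD y h0)
  simp_rw [hpt]
  have hterm (j k : Fin 4) : Integrable fun y => (fderiv ℝ η y (qe j) • fderiv ℝ v y (qe k)
        - fderiv ℝ η y (qe k) • fderiv ℝ v y (qe j)) * ((2⁻¹ : ℝ) • (qe j * star (qe k))) :=
    ((hint _ _).sub (hint _ _)).mul_const _
  rw [integral_finsetSum _ fun j _ => integrable_finsetSum _ fun k _ => hterm j k]
  refine Finset.sum_eq_zero fun j _ => ?_
  rw [integral_finsetSum _ fun k _ => hterm j k]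
  refine Finset.sum_eq_zero fun k _ => ?_
  refine (integral_mul_const_of_integrable ((hint _ _).sub (hint _ _))).trans ?_
  simp only [Pi.sub_apply]
  rw [integral_sub (hint _ _) (hint _ _),
    integral_fderiv_smul_fderiv_comm volume hv hη hc, sub_self, zero_mul]

theorem sum_inner_qe_smul (y : ℍ[ℝ]) : ∑ j, ⟪y, qe j⟫_ℝ • qe j = y := by
  simp only [Fin.sum_univ_four, Quaternion.inner_def]
  ext <;> simp [qe_re, qe_imI, qe_imJ, qe_imK]

/-- The radial field `y ↦ θ(‖y‖²) y` is a gradient, hence orthogonal in the mean to the derivative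
of a solution of the Dirac equation. -/
theorem integral_bump_smul_fderiv_self {v : ℍ[ℝ] → ℍ[ℝ]} (hv : ContDiff ℝ 1 v)
    (θ : ContDiffBump (0 : ℝ)) (hD : ∀ y : ℍ[ℝ], ‖y‖ ^ 2 ≤ θ.rOut → Dirac v y = 0) :
    ∫ y : ℍ[ℝ], θ (‖y‖ ^ 2) • fderiv ℝ v y y = 0 := by
  set Θ : ℝ → ℝ := fun t => ∫ s in θ.rOut..t, θ s
  have hΘ (t : ℝ) : HasDerivAt Θ (θ t) t :=
    intervalIntegral.integral_hasDerivAt_right (θ.continuous.intervalIntegrable _ _)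
      (θ.continuous.stronglyMeasurableAtFilter _ _) θ.continuous.continuousAt
  have hΘ2 : ContDiff ℝ 2 Θ := by
    rw [show (2 : WithTop ℕ∞) = 1 + 1 by norm_num, contDiff_succ_iff_deriv]
    refine ⟨fun t => (hΘ t).differentiableAt, by simp, ?_⟩
    rw [show deriv Θ = θ from funext fun t => (hΘ t).deriv]
    exact θ.contDiff
  have hΘ0 (t : ℝ) (ht : θ.rOut ≤ t) : Θ t = 0 := by
    refine intervalIntegral.integral_zero_ae (.of_forall fun s hs => ?_)
    rw [Set.uIoc_of_le ht] at hs
    refine θ.zero_of_le_dist ?_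
    rw [dist_zero_right]
    exact hs.1.le.trans (le_abs_self s)
  set η : ℍ[ℝ] → ℝ := fun y => 2⁻¹ * Θ (‖y‖ ^ 2)
  have hη : ContDiff ℝ 2 η := contDiff_const.mul (hΘ2.comp (contDiff_norm_sq ℝ))
  have hη' (y e : ℍ[ℝ]) : fderiv ℝ η y e = θ (‖y‖ ^ 2) * ⟪y, e⟫_ℝ := by
    have h1 : HasFDerivAt η ((2⁻¹ : ℝ) • (θ (‖y‖ ^ 2) • (2 • innerSL ℝ y))) y :=
      ((hΘ _).comp_hasFDerivAt y (hasStrictFDerivAt_norm_sq y).hasFDerivAt).const_mul _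
    rw [h1.fderiv]
    simp
    ring
  have hc : HasCompactSupport η := by
    refine HasCompactSupport.intro (isCompact_closedBall (0 : ℍ[ℝ]) (θ.rOut + 1)) fun y hy => ?_
    simp only [mem_closedBall, dist_zero_right, not_le] at hy
    have := θ.rOut_pos
    simp only [η]
    rw [hΘ0 _ (by nlinarith), mul_zero]
  have h0 := integral_sum_fderiv_smul_eq_zero hv hη hc fun y hy => by
    refine hD y (le_of_not_gt fun hlt => hy ?_)
    ext e
    rw [hη', θ.zero_of_le_dist]
    · simp
    · rw [dist_zero_right, Real.norm_of_nonneg (by positivity)]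
      exact hlt.le
  rw [← h0]
  congr 1
  ext1 y
  simp_rw [hη', mul_smul, ← Finset.smul_sum, ← map_smul, ← map_sum, sum_inner_qe_smul, map_smul]

theorem fderiv_comp_add_smul {f : ℍ[ℝ] → ℍ[ℝ]} (hf : Differentiable ℝ f) (x : ℍ[ℝ]) (s : ℝ)
    (y : ℍ[ℝ]) : fderiv ℝ (fun y => f (x + s • y)) y = s • fderiv ℝ f (x + s • y) := by
  have h1 : HasFDerivAt (fun y : ℍ[ℝ] => x + s • y)
      (s • ContinuousLinearMap.id ℝ ℍ[ℝ]) y :=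
    ((hasFDerivAt_id y).const_smul s).const_add x
  refine ((hf (x + s • y)).hasFDerivAt.comp y h1).fderiv.trans ?_
  ext1 e
  simp

theorem hasCompactSupport_bump_norm_sq (θ : ContDiffBump (0 : ℝ)) :
    HasCompactSupport fun y : ℍ[ℝ] => θ (‖y‖ ^ 2) := by
  refine HasCompactSupport.intro (isCompact_closedBall (0 : ℍ[ℝ]) (θ.rOut + 1)) fun y hy => ?_
  simp only [mem_closedBall, dist_zero_right, not_le] at hy
  have := θ.rOut_pos
  refine θ.zero_of_le_dist ?_
  rw [dist_zero_right, Real.norm_of_nonneg (by positivity)]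
  nlinarith

theorem contDiff_bump_norm_sq (θ : ContDiffBump (0 : ℝ)) {n : ℕ∞} :
    ContDiff ℝ n fun y : ℍ[ℝ] => θ (‖y‖ ^ 2) :=
  θ.contDiff.comp (contDiff_norm_sq ℝ)

theorem hasDerivAt_integral_bump_smul {f : ℍ[ℝ] → ℍ[ℝ]} (hf : ContDiff ℝ 1 f)
    (θ : ContDiffBump (0 : ℝ)) (x : ℍ[ℝ]) (s : ℝ) :
    HasDerivAt (fun s : ℝ => ∫ y : ℍ[ℝ], θ (‖y‖ ^ 2) • f (x + s • y))
      (∫ y : ℍ[ℝ], θ (‖y‖ ^ 2) • fderiv ℝ f (x + s • y) y) s := by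
  have hcs := hasCompactSupport_bump_norm_sq θ
  have hθ : Continuous fun y : ℍ[ℝ] => θ (‖y‖ ^ 2) := (contDiff_bump_norm_sq θ (n := 0)).continuous
  have hf' := hf.continuous_fderiv one_ne_zero
  have hcont : Continuous fun q : ℝ × ℍ[ℝ] =>
      θ (‖q.2‖ ^ 2) • fderiv ℝ f (x + q.1 • q.2) q.2 := by
    refine (hθ.comp continuous_snd).smul (Continuous.clm_apply (hf'.comp ?_) continuous_snd)
    fun_prop
  set K := tsupport fun y : ℍ[ℝ] => θ (‖y‖ ^ 2)
  obtain ⟨C, hC⟩ := ((isCompact_closedBall s 1).prod hcs).exists_bound_of_continuousOn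
    hcont.continuousOn
  have hFc (t : ℝ) : Continuous fun y : ℍ[ℝ] => θ (‖y‖ ^ 2) • f (x + t • y) :=
    hθ.smul (hf.continuous.comp (by fun_prop))
  refine (hasDerivAt_integral_of_dominated_loc_of_deriv_le (ball_mem_nhds s one_pos)
    (bound := K.indicator fun _ => C)
    (F' := fun t y => θ (‖y‖ ^ 2) • fderiv ℝ f (x + t • y) y)
    (.of_forall fun t => (hFc t).aestronglyMeasurable)
    ((hFc s).integrable_of_hasCompactSupport hcs.smul_right)
    (hcont.comp (Continuous.prodMk_right s)).aestronglyMeasurable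
    (.of_forall fun y t ht => ?_) ?_ (.of_forall fun y t _ => ?_)).2
  · by_cases hy : y ∈ K
    · rw [Set.indicator_of_mem hy]
      exact hC (t, y) ⟨ball_subset_closedBall ht, hy⟩
    · have h0 : (θ (‖y‖ ^ 2) : ℝ) = 0 :=
        image_eq_zero_of_notMem_tsupport (f := fun y : ℍ[ℝ] => θ (‖y‖ ^ 2)) hy
      simp [Set.indicator_of_notMem hy, h0]
  · rw [integrable_indicator_iff (isClosed_tsupport _).measurableSet]
    exact integrableOn_const hcs.isCompact.measure_lt_top.ne
  · have h1 : HasDerivAt (fun t : ℝ => x + t • y) y t := by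
      simpa using ((hasDerivAt_id t).smul_const y).const_add x
    exact ((hf.differentiable one_ne_zero _).hasFDerivAt.comp_hasDerivAt t h1).const_smul
      (θ (‖y‖ ^ 2) : ℝ)

/-- Mean value property of solutions of the Dirac equation. -/
theorem integral_bump_smul_add {f : ℍ[ℝ] → ℍ[ℝ]} (hf : ContDiff ℝ 1 f)
    (θ : ContDiffBump (0 : ℝ)) (x : ℍ[ℝ])
    (hD : ∀ y : ℍ[ℝ], ‖y‖ ^ 2 ≤ θ.rOut → Dirac f (x + y) = 0) :
    ∫ y : ℍ[ℝ], θ (‖y‖ ^ 2) • f (x + y) = (∫ y : ℍ[ℝ], θ (‖y‖ ^ 2)) • f x := by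
  have hdiff := hf.differentiable one_ne_zero
  have hzero (s : ℝ) (hs : s ∈ Set.Ico (0 : ℝ) 1) :
      ∫ y : ℍ[ℝ], θ (‖y‖ ^ 2) • fderiv ℝ f (x + s • y) y = 0 := by
    rcases eq_or_ne s 0 with rfl | hs0
    · have := integral_bump_smul_fderiv_self (v := fderiv ℝ f x)
        (fderiv ℝ f x).contDiff θ fun y _ => by
          have h0 := hD 0 (by simpa using θ.rOut_pos.le)
          simpa [Dirac] using h0
      simpa using this
    · have := integral_bump_smul_fderiv_self (v := fun y => f (x + s • y))
        (hf.comp (by fun_prop)) θ fun y hy => by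
          have h0 := hD (s • y) (by
            rw [norm_smul, mul_pow, Real.norm_of_nonneg hs.1]
            have : s ^ 2 ≤ 1 := pow_le_one₀ hs.1 hs.2.le
            nlinarith [sq_nonneg ‖y‖])
          simp only [Dirac, fderiv_comp_add_smul hdiff, smul_apply, smul_mul_assoc,
            ← Finset.smul_sum] at h0 ⊢
          rw [h0, smul_zero]
      simp only [fderiv_comp_add_smul hdiff, smul_apply, smul_comm _ s] at this
      rw [integral_smul] at this
      exact (smul_eq_zero.1 this).resolve_left hs0
  have hconst := constant_of_derivWithin_zero (a := 0) (b := 1)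
    (fun s _ => (hasDerivAt_integral_bump_smul hf θ x s).differentiableAt.differentiableWithinAt)
    (fun s hs => by
      rw [(hasDerivAt_integral_bump_smul hf θ x s).hasDerivWithinAt.derivWithin
        (uniqueDiffOn_Icc one_pos s (Set.Ico_subset_Icc_self hs)), hzero s hs])
    1 (Set.right_mem_Icc.2 zero_le_one)
  simpa [integral_smul_const] using hconst

open scoped Convolution

/-- Solutions of the Dirac equation on the unit ball are locally reproduced by convolution with a
smooth real kernel. -/
theorem exists_reproducing_kernel {z : ℍ[ℝ]} (hz : z ∈ ball (0 : ℍ[ℝ]) 1) :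
    ∃ k : ℍ[ℝ] → ℝ, ContDiff ℝ 1 k ∧ HasCompactSupport k ∧ ∃ U ∈ 𝓝 z, ∀ f : ℍ[ℝ] → ℍ[ℝ],
      ContDiffOn ℝ 1 f (ball 0 1) → (∀ w ∈ ball (0 : ℍ[ℝ]) 1, Dirac f w = 0) →
      ∀ x ∈ U, f x =
        ((ball (0 : ℍ[ℝ]) 1).indicator f ⋆[(ContinuousLinearMap.lsmul ℝ ℝ).flip] k) x := by
  rw [mem_ball_zero_iff] at hz
  set ε := (1 - ‖z‖) / 3 with hε
  have hε0 : 0 < ε := by rw [hε]; linarith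
  have hz0 := norm_nonneg z
  let θ : ContDiffBump (0 : ℝ) := ⟨ε ^ 2 / 2, ε ^ 2, by positivity, half_lt_self (by positivity)⟩
  let χ : ContDiffBump (0 : ℍ[ℝ]) :=
    ⟨‖z‖ + 2 * ε, ‖z‖ + 5 / 2 * ε, by positivity, by linarith⟩
  have hθc : Continuous fun y : ℍ[ℝ] => θ (‖y‖ ^ 2) := (contDiff_bump_norm_sq θ (n := 0)).continuous
  set c := ∫ y : ℍ[ℝ], θ (‖y‖ ^ 2)
  have hc : 0 < c := hθc.integral_pos_of_hasCompactSupport_nonneg_nonzero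
    (hasCompactSupport_bump_norm_sq θ) (fun _ => θ.nonneg) (x := 0) (by
      rw [θ.one_of_mem_closedBall (by simpa using θ.rIn_pos.le)]
      exact one_ne_zero)
  refine ⟨fun y => c⁻¹ • θ (‖y‖ ^ 2), (contDiff_bump_norm_sq θ (n := 1)).const_smul _,
    (hasCompactSupport_bump_norm_sq θ).smul_left (f := fun _ => c⁻¹),
    ball z ε, ball_mem_nhds z hε0, fun f hf hD x hx => ?_⟩
  have hxz : ‖x‖ < ‖z‖ + ε := by
    have := norm_le_norm_add_norm_sub' x z
    rw [mem_ball_iff_norm] at hx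
    linarith
  have hχf : ContDiff ℝ 1 fun y => χ y • f y := by
    refine contDiff_iff_contDiffAt.2 fun y => ?_
    by_cases hy : y ∈ tsupport fun y => χ y • f y
    swap
    · exact contDiffAt_const.congr_of_eventuallyEq (notMem_tsupport_iff_eventuallyEq.1 hy)
    have hy' := tsupport_smul_subset_left (χ : ℍ[ℝ] → ℝ) f hy
    rw [χ.tsupport_eq, mem_closedBall_zero_iff] at hy'
    refine χ.contDiffAt.smul (hf.contDiffAt (isOpen_ball.mem_nhds ?_))
    rw [mem_ball_zero_iff]
    refine hy'.trans_lt ?_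
    change ‖z‖ + 5 / 2 * ε < 1
    linarith
  have heq (w : ℍ[ℝ]) (hw : ‖w‖ < ‖z‖ + 2 * ε) : (fun y => χ y • f y) =ᶠ[𝓝 w] f := by
    filter_upwards [isOpen_ball.mem_nhds (mem_ball_zero_iff.2 hw)] with y hy
    rw [χ.one_of_mem_closedBall (ball_subset_closedBall hy), one_smul]
  have hshift (y : ℍ[ℝ]) (hy : ‖y‖ ^ 2 ≤ ε ^ 2) : ‖x + y‖ < ‖z‖ + 2 * ε := by
    have h1 := norm_add_le x y
    have h2 := (sq_le_sq₀ (norm_nonneg y) hε0.le).1 hy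
    linarith
  have hmean := integral_bump_smul_add hχf θ x fun y hy => by
    have h1 := hshift y hy
    rw [Dirac, (heq _ h1).fderiv_eq]
    exact hD _ (mem_ball_zero_iff.2 (by linarith))
  rw [(heq x (by linarith)).eq_of_nhds] at hmean
  have hrep : ∫ y : ℍ[ℝ], θ (‖y‖ ^ 2) • (ball (0 : ℍ[ℝ]) 1).indicator f (x + y) = c • f x := by
    rw [← hmean]
    congr 1
    ext1 y
    by_cases hy : ‖y‖ ^ 2 ≤ ε ^ 2
    · have h1 := hshift y hy
      rw [(heq _ h1).eq_of_nhds, Set.indicator_of_mem (mem_ball_zero_iff.2 (by linarith))]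
    · rw [θ.zero_of_le_dist, zero_smul, zero_smul]
      rw [dist_zero_right, Real.norm_of_nonneg (by positivity)]
      exact (not_le.1 hy).le
  rw [convolution_def]
  have hsub := integral_sub_right_eq_self (μ := volume)
    (fun y : ℍ[ℝ] => θ (‖y‖ ^ 2) • (ball (0 : ℍ[ℝ]) 1).indicator f (x + y)) x
  rw [hrep] at hsub
  simp only [ContinuousLinearMap.flip_apply, ContinuousLinearMap.lsmul_apply, smul_assoc]
  rw [integral_smul]
  simp only [add_sub_cancel] at hsub
  simp only [norm_sub_rev x, hsub, inv_smul_smul₀ hc.ne']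

/-- Convolution with a compactly supported continuous kernel is pointwise continuous in `L¹`. -/
theorem tendsto_convolution_of_tendsto_eLpNorm_one {F G H : Type*} [NormedAddCommGroup F]
    [NormedSpace ℝ F] [NormedAddCommGroup G] [NormedSpace ℝ G] [NormedAddCommGroup H]
    [NormedSpace ℝ H] (L : F →L[ℝ] G →L[ℝ] H) {k : ℍ[ℝ] → G} (hk : Continuous k)
    (hkc : HasCompactSupport k) {f : ℕ → ℍ[ℝ] → F} {g : ℍ[ℝ] → F}
    (hf : ∀ n, Integrable (f n)) (hg : Integrable g)
    (hfg : Tendsto (fun n => eLpNorm (f n - g) 1 volume) atTop (𝓝 0)) (x : ℍ[ℝ]) :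
    Tendsto (fun n => (f n ⋆[L] k) x) atTop (𝓝 ((g ⋆[L] k) x)) := by
  obtain ⟨C, hC⟩ := hkc.exists_bound_of_continuous hk
  have hC0 : 0 ≤ C := (norm_nonneg _).trans (hC 0)
  simp_rw [convolution_def]
  have hint {u : ℍ[ℝ] → F} (hu : Integrable u) : Integrable fun t => L (u t) (k (x - t)) :=
    (hkc.convolutionExists_right L hu.locallyIntegrable hk x).integrable
  refine tendsto_integral_of_L1 _ (hint hg).aestronglyMeasurable
    (.of_forall fun n => hint (hf n)) ?_
  have hlim : Tendsto (fun n => ENNReal.ofReal (‖L‖ * C) * eLpNorm (f n - g) 1 volume)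
      atTop (𝓝 0) := by
    simpa using ENNReal.Tendsto.const_mul hfg (Or.inr ENNReal.ofReal_ne_top)
  refine tendsto_of_tendsto_of_tendsto_of_le_of_le tendsto_const_nhds hlim (fun _ => zero_le)
    fun n => ?_
  simp only [eLpNorm_one_eq_lintegral_enorm]
  rw [← lintegral_const_mul' _ _ ENNReal.ofReal_ne_top]
  refine lintegral_mono fun t => ?_
  simp only [← ofReal_norm, Pi.sub_apply]
  rw [← ENNReal.ofReal_mul (by positivity), ← sub_apply, ← map_sub]
  refine ENNReal.ofReal_le_ofReal ((L.le_opNorm₂ _ _).trans ?_)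
  rw [mul_right_comm]
  gcongr
  exact hC _

/-- `L¹` limits of solutions of the Dirac equation converge pointwise in the ball to a solution. -/
theorem contDiffAt_and_dirac_of_tendsto_L1 {f : ℕ → ℍ[ℝ] → ℍ[ℝ]}
    (hf : ∀ n, ContDiffOn ℝ 1 (f n) (ball 0 1))
    (hD : ∀ n, ∀ w ∈ ball (0 : ℍ[ℝ]) 1, Dirac (f n) w = 0)
    (hint : ∀ n, Integrable ((ball (0 : ℍ[ℝ]) 1).indicator (f n))) {G : ℍ[ℝ] → ℍ[ℝ]}
    (hG : Integrable G)
    (hlim : Tendsto (fun n => eLpNorm ((ball (0 : ℍ[ℝ]) 1).indicator (f n) - G) 1 volume)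
      atTop (𝓝 0)) {z : ℍ[ℝ]} (hz : z ∈ ball (0 : ℍ[ℝ]) 1) {g : ℍ[ℝ] → ℍ[ℝ]}
    (hg : ∀ x ∈ ball (0 : ℍ[ℝ]) 1, ∀ l, Tendsto (fun n => f n x) atTop (𝓝 l) → g x = l) :
    Tendsto (fun n => f n z) atTop (𝓝 (g z)) ∧ ContDiffAt ℝ 1 g z ∧ Dirac g z = 0 := by
  obtain ⟨k, hk, hkc, U, hU, hrep⟩ := exists_reproducing_kernel hz
  set L : ℍ[ℝ] →L[ℝ] ℝ →L[ℝ] ℍ[ℝ] := (ContinuousLinearMap.lsmul ℝ ℝ).flip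
  have hlimx (x : ℍ[ℝ]) (hx : x ∈ U) : Tendsto (fun n => f n x) atTop (𝓝 ((G ⋆[L] k) x)) :=
    (tendsto_convolution_of_tendsto_eLpNorm_one L hk.continuous hkc hint hG hlim x).congr
      fun n => (hrep (f n) (hf n) (hD n) x hx).symm
  have hgG : g =ᶠ[𝓝 z] G ⋆[L] k := by
    filter_upwards [hU, isOpen_ball.mem_nhds hz] with x hx hx1
    exact hg x hx1 _ (hlimx x hx)
  have hgz := hgG.eq_of_nhds
  refine ⟨hgz ▸ hlimx z (mem_of_mem_nhds hU),
    (hkc.contDiff_convolution_right L hG.locallyIntegrable hk).contDiffAt.congr_of_eventuallyEq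
      hgG, ?_⟩
  have hfd (n : ℕ) := ((hkc.hasFDerivAt_convolution_right L (hint n).locallyIntegrable hk
    z).congr_of_eventuallyEq (eventuallyEq_of_mem hU (hrep (f n) (hf n) (hD n)))).fderiv
  have hfg : Tendsto (fun n => fderiv ℝ (f n) z) atTop (𝓝 (fderiv ℝ g z)) := by
    rw [hgG.fderiv_eq,
      (hkc.hasFDerivAt_convolution_right L hG.locallyIntegrable hk z).fderiv]
    simp_rw [hfd]
    exact tendsto_convolution_of_tendsto_eLpNorm_one _ (hk.continuous_fderiv one_ne_zero)
      (hkc.fderiv ℝ) hint hG hlim z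
  have hDlim : Tendsto (fun n => Dirac (f n) z) atTop (𝓝 (Dirac g z)) :=
    tendsto_finsetSum _ fun j _ => Tendsto.mul_const _
      (((ContinuousLinearMap.apply ℝ ℍ[ℝ] (qe j)).continuous.tendsto _).comp hfg)
  simp_rw [hD _ z hz] at hDlim
  exact tendsto_nhds_unique hDlim tendsto_const_nhds

theorem ofReal_norm_rpow {E : Type*} [SeminormedAddGroup E] {p : ℝ} (hp : 0 ≤ p) (a : E) :
    ENNReal.ofReal (‖a‖ ^ p) = ‖a‖ₑ ^ p := by
  rw [← ENNReal.ofReal_rpow_of_nonneg (norm_nonneg a) hp, ofReal_norm]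

theorem hardyNorm_le_iff {ψ : Measure ℍ[ℝ]} {p : ℝ} (hp : 0 < p) {f : ℍ[ℝ] → ℍ[ℝ]} {C : ℝ≥0∞} :
    hardyNorm ψ p f ≤ C ↔ ∀ r ∈ Set.Ioc (0 : ℝ) 1,
      ENNReal.ofReal (r ^ (-(3 : ℝ))) * ∫⁻ y, ‖f (r • y)‖ₑ ^ p ∂ψ ≤ C ^ p := by
  rw [hardyNorm, one_div, ENNReal.rpow_inv_le_iff hp, iSup₂_le_iff]
  simp_rw [ofReal_norm_rpow hp.le]

theorem eLpNorm_le_hardyNorm {ψ : Measure ℍ[ℝ]} {p : ℝ} (hp : 0 < p) (f : ℍ[ℝ] → ℍ[ℝ]) :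
    eLpNorm f (ENNReal.ofReal p) ψ ≤ hardyNorm ψ p f := by
  have h1 := (hardyNorm_le_iff (ψ := ψ) hp (f := f)).1 le_rfl 1 ⟨one_pos, le_rfl⟩
  rw [eLpNorm_eq_lintegral_rpow_enorm_toReal (by simpa using hp) ENNReal.ofReal_ne_top,
    ENNReal.toReal_ofReal hp.le, one_div, ENNReal.rpow_inv_le_iff hp]
  simpa using h1

/-- Left multiplication by a unit quaternion as a linear isometry. -/
noncomputable def mulLeftIsometry (q : ℍ[ℝ]) (hq : ‖q‖ = 1) : ℍ[ℝ] ≃ₗᵢ[ℝ] ℍ[ℝ] :=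
  LinearIsometry.toLinearIsometryEquiv ⟨LinearMap.mulLeft ℝ q, fun x => by simp [hq]⟩ rfl

/-- Right multiplication by a unit quaternion as a linear isometry. -/
noncomputable def mulRightIsometry (q : ℍ[ℝ]) (hq : ‖q‖ = 1) : ℍ[ℝ] ≃ₗᵢ[ℝ] ℍ[ℝ] :=
  LinearIsometry.toLinearIsometryEquiv ⟨LinearMap.mulRight ℝ q, fun x => by simp [hq]⟩ rfl

theorem isProbabilityMeasure_of_sphere {ψ : Measure ℍ[ℝ]} (hψone : ψ (sphere (0 : ℍ[ℝ]) 1) = 1)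
    (hψsupp : ψ (sphere (0 : ℍ[ℝ]) 1)ᶜ = 0) : IsProbabilityMeasure ψ := by
  refine ⟨?_⟩
  rw [← measure_add_measure_compl (μ := ψ) isClosed_sphere.measurableSet, hψone, hψsupp, add_zero]

/-- Integration in polar coordinates: averaging over the spheres centred at the origin does not
change a Lebesgue integral. -/
theorem lintegral_eq_lintegral_lintegral_sphere {ψ : Measure ℍ[ℝ]}
    (hψone : ψ (sphere (0 : ℍ[ℝ]) 1) = 1) (hψsupp : ψ (sphere (0 : ℍ[ℝ]) 1)ᶜ = 0)
    (hψrot : ∀ T : ℍ[ℝ] ≃ₗᵢ[ℝ] ℍ[ℝ], ψ.map T = ψ) {φ : ℍ[ℝ] → ℝ≥0∞} (hφ : Measurable φ) :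
    ∫⁻ x, φ x = ∫⁻ x : ℍ[ℝ], ∫⁻ y, φ (‖x‖ • y) ∂ψ := by
  have := isProbabilityMeasure_of_sphere hψone hψsupp
  have hsph : ∀ᵐ q ∂ψ, q ∈ sphere (0 : ℍ[ℝ]) 1 := hψsupp
  have hmul (q : ℍ[ℝ]) (hq : q ∈ sphere (0 : ℍ[ℝ]) 1) : ∫⁻ x, φ (q * x) = ∫⁻ x, φ x :=
    (mulLeftIsometry q (mem_sphere_zero_iff_norm.1 hq)).measurePreserving.lintegral_comp hφ
  have hinner (x : ℍ[ℝ]) : ∫⁻ q, φ (q * x) ∂ψ = ∫⁻ y, φ (‖x‖ • y) ∂ψ := by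
    rcases eq_or_ne x 0 with rfl | hx
    · simp
    · set u := ‖x‖⁻¹ • x
      have hu : ‖u‖ = 1 := by
        rw [norm_smul, norm_inv, norm_norm, inv_mul_cancel₀ (norm_ne_zero_iff.2 hx)]
      have hxu (q : ℍ[ℝ]) : q * x = ‖x‖ • (q * u) := by
        rw [mul_smul_comm, smul_inv_smul₀ (norm_ne_zero_iff.2 hx)]
      simp_rw [hxu]
      conv_rhs => rw [← hψrot (mulRightIsometry u hu)]
      have hφx : Measurable fun y : ℍ[ℝ] => φ (‖x‖ • y) := hφ.comp (measurable_const_smul _)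
      rw [lintegral_map hφx (mulRightIsometry u hu).continuous.measurable]
      rfl
  calc ∫⁻ x, φ x = ∫⁻ _, (∫⁻ x, φ x) ∂ψ := by simp
    _ = ∫⁻ q, (∫⁻ x, φ (q * x)) ∂ψ := lintegral_congr_ae (hsph.mono fun q hq => (hmul q hq).symm)
    _ = ∫⁻ x, ∫⁻ q, φ (q * x) ∂ψ :=
      lintegral_lintegral_swap (hφ.comp (measurable_fst.mul measurable_snd)).aemeasurable
    _ = _ := lintegral_congr hinner

theorem lintegral_ball_le_hardyNorm {ψ : Measure ℍ[ℝ]}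
    (hψone : ψ (sphere (0 : ℍ[ℝ]) 1) = 1) (hψsupp : ψ (sphere (0 : ℍ[ℝ]) 1)ᶜ = 0)
    (hψrot : ∀ T : ℍ[ℝ] ≃ₗᵢ[ℝ] ℍ[ℝ], ψ.map T = ψ) {p : ℝ} (hp : 0 < p) {f : ℍ[ℝ] → ℍ[ℝ]}
    (hf : Measurable f) :
    ∫⁻ x in ball (0 : ℍ[ℝ]) 1, ‖f x‖ₑ ^ p ≤
      hardyNorm ψ p f ^ p * volume (ball (0 : ℍ[ℝ]) 1) := by
  have hsph : ∀ᵐ q ∂ψ, q ∈ sphere (0 : ℍ[ℝ]) 1 := hψsupp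
  rw [← lintegral_indicator isOpen_ball.measurableSet,
    lintegral_eq_lintegral_lintegral_sphere hψone hψsupp hψrot
      ((hf.enorm.pow_const p).indicator isOpen_ball.measurableSet),
    ← lintegral_indicator_const isOpen_ball.measurableSet]
  have hne : ∀ᵐ x : ℍ[ℝ], x ≠ 0 := by simp [ae_iff]
  refine lintegral_mono_ae (hne.mono fun x hx0 => ?_)
  have hnorm : ∀ᵐ y ∂ψ, ‖‖x‖ • y‖ = ‖x‖ := hsph.mono fun y hy => by
    rw [norm_smul, mem_sphere_zero_iff_norm.1 hy, norm_norm, mul_one]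
  by_cases hx : x ∈ ball (0 : ℍ[ℝ]) 1
  · rw [Set.indicator_of_mem hx]
    rw [mem_ball_zero_iff] at hx
    have hxpos := norm_pos_iff.2 hx0
    refine le_trans ?_ ((hardyNorm_le_iff (ψ := ψ) hp (f := f)).1 le_rfl ‖x‖ ⟨hxpos, hx.le⟩)
    refine le_trans (lintegral_mono fun y => Set.indicator_le_self _ _ _) (le_mul_of_one_le_left' ?_)
    rw [ENNReal.one_le_ofReal]
    exact Real.one_le_rpow_of_pos_of_le_one_of_nonpos hxpos hx.le (by norm_num)
  · rw [Set.indicator_of_notMem hx, lintegral_congr_ae (g := 0) ?_]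
    · simp
    · filter_upwards [hnorm] with y hy
      refine Set.indicator_of_notMem (fun hy' => hx ?_) _
      rw [mem_ball_zero_iff] at hy' ⊢
      rwa [hy] at hy'

theorem exists_eLpNorm_one_indicator_le {ψ : Measure ℍ[ℝ]}
    (hψone : ψ (sphere (0 : ℍ[ℝ]) 1) = 1) (hψsupp : ψ (sphere (0 : ℍ[ℝ]) 1)ᶜ = 0)
    (hψrot : ∀ T : ℍ[ℝ] ≃ₗᵢ[ℝ] ℍ[ℝ], ψ.map T = ψ) {p : ℝ} (hp : 1 ≤ p) :
    ∃ C : ℝ≥0∞, C ≠ ⊤ ∧ ∀ f : ℍ[ℝ] → ℍ[ℝ], Measurable f →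
      eLpNorm ((ball (0 : ℍ[ℝ]) 1).indicator f) 1 volume ≤ C * hardyNorm ψ p f := by
  have hp0 : 0 < p := one_pos.trans_le hp
  set V := volume (ball (0 : ℍ[ℝ]) 1)
  have hV : V ≠ ⊤ := measure_ball_lt_top.ne
  refine ⟨V ^ p⁻¹ * V ^ (1 - 1 / p), ENNReal.mul_ne_top
    (ENNReal.rpow_ne_top_of_nonneg (by positivity) hV)
    (ENNReal.rpow_ne_top_of_nonneg (by rw [sub_nonneg, div_le_one hp0]; exact hp) hV),
    fun f hf => ?_⟩
  rw [eLpNorm_indicator_eq_eLpNorm_restrict isOpen_ball.measurableSet]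
  refine (eLpNorm_le_eLpNorm_mul_rpow_measure_univ (q := ENNReal.ofReal p)
    (by simpa using hp) hf.aestronglyMeasurable).trans ?_
  rw [ENNReal.toReal_ofReal hp0.le, Measure.restrict_apply_univ, ENNReal.toReal_one, div_one,
    mul_right_comm]
  gcongr
  rw [eLpNorm_eq_lintegral_rpow_enorm_toReal (by simpa using hp0) ENNReal.ofReal_ne_top,
    ENNReal.toReal_ofReal hp0.le, one_div, ENNReal.rpow_inv_le_iff hp0,
    ENNReal.mul_rpow_of_nonneg _ _ hp0.le, ENNReal.rpow_inv_rpow hp0.ne', mul_comm]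
  exact lintegral_ball_le_hardyNorm hψone hψsupp hψrot hp0 hf

theorem hardyNorm_add_lt_top {ψ : Measure ℍ[ℝ]} {p : ℝ} (hp : 1 ≤ p) {f g : ℍ[ℝ] → ℍ[ℝ]}
    (hf : Measurable f) (hft : hardyNorm ψ p f < ⊤) (hgt : hardyNorm ψ p g < ⊤) :
    hardyNorm ψ p (fun z => f z + g z) < ⊤ := by
  have hp0 : 0 < p := one_pos.trans_le hp
  set C := 2 ^ (p - 1) * (hardyNorm ψ p f ^ p + hardyNorm ψ p g ^ p)
  have hC : C ≠ ⊤ := ENNReal.mul_ne_top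
    (ENNReal.rpow_ne_top_of_nonneg (by linarith) ENNReal.ofNat_ne_top)
    (ENNReal.add_ne_top.2 ⟨ENNReal.rpow_ne_top_of_nonneg hp0.le hft.ne,
      ENNReal.rpow_ne_top_of_nonneg hp0.le hgt.ne⟩)
  refine lt_of_le_of_lt (b := C ^ p⁻¹) ((hardyNorm_le_iff hp0).2 fun r hr => ?_)
    (ENNReal.rpow_lt_top_of_nonneg (by positivity) hC)
  rw [ENNReal.rpow_inv_rpow hp0.ne']
  have h1 := (hardyNorm_le_iff (ψ := ψ) hp0 (f := f)).1 le_rfl r hr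
  have h2 := (hardyNorm_le_iff (ψ := ψ) hp0 (f := g)).1 le_rfl r hr
  refine le_trans ?_ (mul_le_mul_right (add_le_add h1 h2) _)
  have hfr : Measurable fun y => ‖f (r • y)‖ₑ ^ p :=
    (hf.comp (measurable_const_smul r)).enorm.pow_const p
  rw [← mul_add, mul_left_comm, ← lintegral_add_left hfr,
    ← lintegral_const_mul' _ _ (ENNReal.rpow_ne_top_of_nonneg (by linarith) ENNReal.ofNat_ne_top)]
  gcongr with y
  exact (ENNReal.rpow_le_rpow (enorm_add_le _ _) hp0.le).trans
    (ENNReal.rpow_add_le_mul_rpow_add_rpow _ _ hp)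

/-- Fatou's lemma for the Hardy norm. -/
theorem hardyNorm_le_of_ae_tendsto {ψ : Measure ℍ[ℝ]} {p : ℝ} (hp : 0 < p)
    {f : ℕ → ℍ[ℝ] → ℍ[ℝ]} {g : ℍ[ℝ] → ℍ[ℝ]} (hf : ∀ n, Measurable (f n))
    (hlim : ∀ r ∈ Set.Ioc (0 : ℝ) 1, ∀ᵐ y ∂ψ,
      Tendsto (fun n => f n (r • y)) atTop (𝓝 (g (r • y)))) {C : ℝ≥0∞}
    (hC : ∀ᶠ n in atTop, hardyNorm ψ p (f n) ≤ C) : hardyNorm ψ p g ≤ C := by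
  refine (hardyNorm_le_iff hp).2 fun r hr => ?_
  have hr' : ENNReal.ofReal (r ^ (-(3 : ℝ))) ≠ ⊤ := ENNReal.ofReal_ne_top
  rw [← lintegral_const_mul' _ _ hr']
  calc ∫⁻ y, ENNReal.ofReal (r ^ (-(3 : ℝ))) * ‖g (r • y)‖ₑ ^ p ∂ψ
      = ∫⁻ y, liminf (fun n => ENNReal.ofReal (r ^ (-(3 : ℝ))) * ‖f n (r • y)‖ₑ ^ p) atTop ∂ψ := by
        refine lintegral_congr_ae ((hlim r hr).mono fun y hy => ?_)
        exact ((ENNReal.Tendsto.const_mul ((ENNReal.continuous_rpow_const.tendsto _).comp hy.enorm)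
          (Or.inr hr')).liminf_eq).symm
    _ ≤ liminf (fun n => ∫⁻ y, ENNReal.ofReal (r ^ (-(3 : ℝ))) * ‖f n (r • y)‖ₑ ^ p ∂ψ) atTop :=
        lintegral_liminf_le fun n =>
          (((hf n).comp (measurable_const_smul r)).enorm.pow_const p).const_mul _
    _ ≤ C ^ p := by
        refine liminf_le_of_frequently_le' (hC.mono fun n hn => ?_).frequently
        rw [lintegral_const_mul' _ _ hr']
        exact (hardyNorm_le_iff hp).1 hn r hr

/-- A Cauchy sequence for the Hardy norm has a geometrically fast Cauchy subsequence. -/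
theorem exists_fast_subsequence {ψ : Measure ℍ[ℝ]} {p : ℝ} {h : ℕ → ℍ[ℝ] → ℍ[ℝ]}
    (hcauchy : ∀ ε : ℝ, 0 < ε → ∃ N : ℕ, ∀ m ≥ N, ∀ n ≥ N,
      hardyNorm ψ p (fun z => h m z - h n z) ≤ ENNReal.ofReal ε) :
    ∃ φ : ℕ → ℕ, Tendsto φ atTop atTop ∧ ∀ N n m : ℕ, N ≤ n → N ≤ m →
      hardyNorm ψ p (h (φ n) - h (φ m)) < 2⁻¹ ^ N := by
  choose M hM using fun k : ℕ => hcauchy ((2⁻¹ : ℝ) ^ (k + 1)) (by positivity)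
  have hle (N n : ℕ) (hn : N ≤ n) : M N ≤ n + ∑ i ∈ Finset.range (n + 1), M i :=
    (Finset.single_le_sum (f := M) (fun _ _ => Nat.zero_le _)
      (Finset.mem_range.2 (Nat.lt_succ_of_le hn))).trans (Nat.le_add_left _ _)
  refine ⟨fun n => n + ∑ i ∈ Finset.range (n + 1), M i,
    tendsto_atTop_mono (fun n => Nat.le_add_right _ _) tendsto_id, fun N n m hn hm => ?_⟩
  refine (hM N _ (hle N n hn) _ (hle N m hm)).trans_lt ?_
  have hpow : (2⁻¹ : ℝ≥0∞) ^ N = ENNReal.ofReal (2⁻¹ ^ N) := by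
    rw [ENNReal.ofReal_pow (by positivity), ENNReal.ofReal_inv_of_pos two_pos, ENNReal.ofReal_ofNat]
  rw [hpow, ENNReal.ofReal_lt_ofReal_iff (by positivity)]
  exact pow_lt_pow_right_of_lt_one₀ (by norm_num) (by norm_num) N.lt_succ_self

theorem exists_measurable_eq_of_tendsto {f : ℕ → ℍ[ℝ] → ℍ[ℝ]} (hf : ∀ n, Measurable (f n)) :
    ∃ g : ℍ[ℝ] → ℍ[ℝ], Measurable g ∧ ∀ x l, Tendsto (fun n => f n x) atTop (𝓝 l) → g x = l := by
  set S := {x | ∃ l, Tendsto (fun n => f n x) atTop (𝓝 l)}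
  have hS : MeasurableSet S := measurableSet_exists_tendsto hf
  have hex (x : ℍ[ℝ]) : ∃ l, Tendsto (fun n => S.indicator (f n) x) atTop (𝓝 l) := by
    by_cases hx : x ∈ S
    · obtain ⟨l, hl⟩ := id hx
      exact ⟨l, by simpa [Set.indicator_of_mem hx] using hl⟩
    · exact ⟨0, by simp [Set.indicator_of_notMem hx]⟩
  choose g hg using hex
  refine ⟨g, measurable_of_tendsto_metrizable (fun n => (hf n).indicator hS)
    (tendsto_pi_nhds.2 hg), fun x l hl => tendsto_nhds_unique (hg x) ?_⟩
  simpa [Set.indicator_of_mem (show x ∈ S from ⟨l, hl⟩)] using hl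

/-- For `1 < p < ∞`, `K_p(B, ℍ)` with the Hardy norm is complete: every Cauchy sequence
converges in the Hardy norm to an element of `K_p(B, ℍ)`; thus `K_p(B, ℍ)` is a Banach
left ℍ-module. Here `ψ` is the rotation-invariant probability measure on `S³`. -/
theorem memKp_complete
    (p : ℝ) (hp : 1 < p)
    (ψ : Measure ℍ[ℝ]) (hψone : ψ (sphere (0 : ℍ[ℝ]) 1) = 1)
    (hψsupp : ψ (sphere (0 : ℍ[ℝ]) 1)ᶜ = 0)
    (hψrot : ∀ T : ℍ[ℝ] ≃ₗᵢ[ℝ] ℍ[ℝ], ψ.map T = ψ)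
    (h : ℕ → (ℍ[ℝ] → ℍ[ℝ])) (hmem : ∀ n, memKp ψ p (h n))
    (hcauchy : ∀ ε : ℝ, 0 < ε → ∃ N : ℕ, ∀ m ≥ N, ∀ n ≥ N,
      hardyNorm ψ p (fun z => h m z - h n z) ≤ ENNReal.ofReal ε) :
    ∃ g : ℍ[ℝ] → ℍ[ℝ], memKp ψ p g ∧ ∀ ε : ℝ, 0 < ε → ∃ N : ℕ, ∀ n ≥ N,
      hardyNorm ψ p (fun z => h n z - g z) ≤ ENNReal.ofReal ε := by
  have hp0 : 0 < p := one_pos.trans hp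
  have := isProbabilityMeasure_of_sphere hψone hψsupp
  have hsph : ∀ᵐ q ∂ψ, q ∈ sphere (0 : ℍ[ℝ]) 1 := hψsupp
  have hm (n : ℕ) : Measurable (h n) := (hmem n).1
  obtain ⟨φ, hφN, hφ⟩ := exists_fast_subsequence hcauchy
  obtain ⟨g, hgm, hg⟩ := exists_measurable_eq_of_tendsto fun n => hm (φ n)
  obtain ⟨C, hC, hCle⟩ := exists_eLpNorm_one_indicator_le hψone hψsupp hψrot hp.le
  have hint (n : ℕ) : Integrable ((ball (0 : ℍ[ℝ]) 1).indicator (h (φ n))) := by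
    rw [← memLp_one_iff_integrable]
    exact ⟨((hm _).indicator isOpen_ball.measurableSet).aestronglyMeasurable,
      (hCle _ (hm _)).trans_lt (ENNReal.mul_lt_top hC.lt_top (hmem _).2.2.2)⟩
  obtain ⟨G, hG, hGlim⟩ := Lp.cauchy_complete_eLpNorm le_rfl
    (fun n => memLp_one_iff_integrable.2 (hint n)) (B := fun n => (C + 1) * 2⁻¹ ^ n)
    (by
      rw [ENNReal.tsum_mul_left, ENNReal.tsum_geometric_two]
      exact ENNReal.mul_ne_top (by simpa using hC) ENNReal.ofNat_ne_top)
    fun N n m hn hm' => by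
      rw [← Set.indicator_sub']
      exact (hCle _ ((hm _).sub (hm _))).trans_lt
        (ENNReal.mul_lt_mul (ENNReal.lt_add_right hC one_ne_zero) (hφ N n m hn hm'))
  have hball (z : ℍ[ℝ]) (hz : z ∈ ball (0 : ℍ[ℝ]) 1) :=
    contDiffAt_and_dirac_of_tendsto_L1 (fun n => (hmem (φ n)).2.1) (fun n => (hmem (φ n)).2.2.1)
      hint (memLp_one_iff_integrable.1 hG) hGlim hz (g := g) fun x _ l hl => hg x l hl
  have hsphere : ∀ᵐ y ∂ψ, Tendsto (fun n => h (φ n) y) atTop (𝓝 (g y)) := by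
    have hae := Lp.ae_tendsto_of_cauchy_eLpNorm (μ := ψ) (p := ENNReal.ofReal p)
      (fun n => (hm (φ n)).aestronglyMeasurable)
      (by simpa using hp.le) (B := fun n => 2⁻¹ ^ n)
      (by rw [ENNReal.tsum_geometric_two]; exact ENNReal.ofNat_ne_top)
      fun N n m hn hm' => (eLpNorm_le_hardyNorm hp0 _).trans_lt (hφ N n m hn hm')
    filter_upwards [hae] with y ⟨l, hl⟩
    rwa [hg y l hl]
  have hlim (r : ℝ) (hr : r ∈ Set.Ioc (0 : ℝ) 1) :
      ∀ᵐ y ∂ψ, Tendsto (fun n => h (φ n) (r • y)) atTop (𝓝 (g (r • y))) := by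
    rcases hr.2.eq_or_lt with rfl | hr1
    · simpa using hsphere
    · filter_upwards [hsph] with y hy
      refine (hball _ ?_).1
      rw [mem_ball_zero_iff, norm_smul, mem_sphere_zero_iff_norm.1 hy, mul_one,
        Real.norm_of_nonneg hr.1.le]
      exact hr1
  have hconv (ε : ℝ) (hε : 0 < ε) : ∃ N : ℕ, ∀ n ≥ N,
      hardyNorm ψ p (fun z => h n z - g z) ≤ ENNReal.ofReal ε := by
    obtain ⟨N, hN⟩ := hcauchy ε hε
    refine ⟨N, fun n hn => hardyNorm_le_of_ae_tendsto (f := fun k z => h n z - h (φ k) z) hp0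
      (fun k => (hm n).sub (hm _)) (fun r hr => (hlim r hr).mono fun y hy => hy.const_sub _) ?_⟩
    filter_upwards [hφN.eventually_ge_atTop N] with k hk using hN n hn _ hk
  refine ⟨g, ⟨hgm, fun z hz => (hball z hz).2.1.contDiffWithinAt, fun z hz => (hball z hz).2.2, ?_⟩,
    hconv⟩
  obtain ⟨N, hN⟩ := hconv 1 one_pos
  have hsub : hardyNorm ψ p (fun z => g z - h N z) < ⊤ := by
    have := (hN N le_rfl).trans_lt ENNReal.ofReal_lt_top
    simpa only [hardyNorm, norm_sub_rev] using this
  simpa using hardyNorm_add_lt_top hp.le (hm N) (hmem N).2.2.2 hsub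
end
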